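/- Let p be any probability vector on {1,…,k}. The process Ĝ=G^{(k)}(X) is a Markov chain on W∩ℤ_+^k with transition matrix P̂(x,y)=(s_{y^*}(p)/s_{x^*}(p))·1{y−x∈{e_1,…,e_k}}. Precisely, for every n≥0, every path g:{0,…,n}→ℤ_+^k with g(0)=0, unit increments g(m)−g(m−1)∈{e_1,…,e_k}, g(m)∈W for all m, and every y∈W∩ℤ_+^k with y−g(n)∈{e_1,…,e_k}: s_{g(n)^*}(p)·P(Ĝ(m)=g(m) for all m≤n, and Ĝ(n+1)=y) = s_{y^*}(p)·P(Ĝ(m)=g(m) for all m≤n). -/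

import Mathlib

open MeasureTheory ProbabilityTheory

noncomputable def minOp (x y : ℕ → ℤ) : ℕ → ℤ := fun n =>
  Finset.inf' (Finset.range (n+1)) (by simp) (fun m => x m + y n - y m)

noncomputable def maxOp (x y : ℕ → ℤ) : ℕ → ℤ := fun n =>
  Finset.sup' (Finset.range (n+1)) (by simp) (fun m => x m + y n - y m)

/-- `Dseq x i = x 0 ⊓ x 1 ⊓ ⋯ ⊓ x i` (left to right). -/
noncomputable def Dseq (x : ℕ → ℕ → ℤ) : ℕ → (ℕ → ℤ)
  | 0 => x 0
  | i+1 => minOp (Dseq x i) (x (i+1))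

/-- `Tseq x i = x (i+1) ⊔ (x 0 ⊓ ⋯ ⊓ x i)`. -/
noncomputable def Tseq (x : ℕ → ℕ → ℤ) : ℕ → (ℕ → ℤ) :=
  fun i => maxOp (x (i+1)) (Dseq x i)

/-- The path transformation `G^{(k)}` (coordinates `0,…,k-1`). -/
noncomputable def G : ℕ → (ℕ → ℕ → ℤ) → (ℕ → ℕ → ℤ)
  | 0, x => x
  | 1, x => x
  | (k+2), x => fun i => match i with
      | 0 => Dseq x (k+1)
      | (j+1) => G (k+1) (Tseq x) j

/-- The cells of the Young diagram of shape `lam` (row lengths), within the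
first `k` rows. -/
def cells (k : ℕ) (lam : ℕ → ℕ) : Finset (ℕ × ℕ) :=
  (Finset.range k ×ˢ Finset.range ((Finset.range k).sup lam)).filter
    (fun rc => rc.2 < lam rc.1)

/-- `T` is a semistandard Young tableau of shape `lam` with entries in
`{0,…,k-1}` (0-based version of entries `{1,…,k}`): rows weakly increase,
columns strictly increase, and `T` vanishes outside the diagram. -/
def IsSSYT (k : ℕ) (lam : ℕ → ℕ) (T : ℕ → ℕ → ℕ) : Prop :=
  (∀ r c, c < lam r → T r c < k) ∧
  (∀ r c, ¬ c < lam r → T r c = 0) ∧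
  (∀ r c c', c ≤ c' → c' < lam r → T r c ≤ T r c') ∧
  (∀ r r' c, r < r' → c < lam r' → T r c < T r' c)

/-- Number of entries of `T` (of shape `lam`, within `k` rows) equal to `i`. -/
def entryCount (k : ℕ) (lam : ℕ → ℕ) (T : ℕ → ℕ → ℕ) (i : ℕ) : ℕ :=
  ((cells k lam).filter (fun rc => T rc.1 rc.2 = i)).card

/-- The Schur polynomial `s_lam(p) = ∑_T p^{weight(T)}`, summing over all
semistandard tableaux of shape `lam` with entries in `{0,…,k-1}`. -/
noncomputable def schur (k : ℕ) (lam : ℕ → ℕ) (p : ℕ → ℝ) : ℝ :=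
  ∑' T : {T : ℕ → ℕ → ℕ // IsSSYT k lam T},
    ∏ i ∈ Finset.range k, p i ^ entryCount k lam T.1 i

/-- The Kostka number `κ_{lam,w}`: the number of semistandard tableaux of shape
`lam` with entries in `{0,…,k-1}` and weight `w`. -/
noncomputable def kostka (k : ℕ) (lam : ℕ → ℕ) (w : ℕ → ℕ) : ℕ :=
  Set.ncard {T : ℕ → ℕ → ℕ | IsSSYT k lam T ∧ ∀ i, i < k → entryCount k lam T i = w i}

/-- The reversed vector `x^*` of a nonnegative integer vector, as a shape. -/
def revPartZ (k : ℕ) (x : ℕ → ℤ) : ℕ → ℕ :=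
  fun j => if j < k then (x (k-1-j)).toNat else 0

/-- The counting walk of the i.i.d. letters `ξ`:
`Xcnt ξ i n ω = #{m < n : ξ m ω = i}` (as an integer). -/
def Xcnt {Ω : Type*} (ξ : ℕ → Ω → ℕ) (i : ℕ) (n : ℕ) (ω : Ω) : ℤ :=
  ((((Finset.range n).filter (fun m => ξ m ω = i))).card : ℤ)

/-! ### One step of the pattern dynamics -/

def PatK (k : ℕ) (Z : ℕ → ℕ → ℕ) : Prop :=
  (∀ r, Z 0 r = 0) ∧ ∀ l, l < k → ∀ r, Z l r ≤ Z (l+1) r ∧ Z (l+1) (r+1) ≤ Z l r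

def fnd (Z : ℕ → ℕ → ℕ) (l r : ℕ) : ℕ :=
  Nat.findGreatest (fun s => s = 0 ∨ Z (l+1) s < Z l (s-1)) r

def rho (Z : ℕ → ℕ → ℕ) (a : ℕ) : ℕ → ℕ
  | 0 => 0
  | l+1 => if l < a then l+1 else fnd Z l (rho Z a l)

def upd (Z : ℕ → ℕ → ℕ) (a l r : ℕ) : ℕ :=
  Z l r + if a < l ∧ r = rho Z a l then 1 else 0

def Zof (w : ℕ → ℕ) : ℕ → ℕ → ℕ → ℕ
  | 0 => fun _ _ => 0
  | n+1 => upd (Zof w n) (w n)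

theorem PatK.mono {k k' : ℕ} {Z} (h : PatK k Z) (hk : k' ≤ k) : PatK k' Z :=
  ⟨h.1, fun l hl => h.2 l (lt_of_lt_of_le hl hk)⟩

theorem PatK.zero {k : ℕ} {Z} (h : PatK k Z) : ∀ l, l ≤ k → ∀ r, l ≤ r → Z l r = 0 := by
  intro l
  induction l with
  | zero => intro _ r _; exact h.1 r
  | succ l ih =>
    intro hl r hr
    obtain ⟨r, rfl⟩ : ∃ r', r = r' + 1 := ⟨r - 1, by omega⟩
    have h1 := (h.2 l (by omega) r).2
    have h2 := ih (by omega) r (by omega)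
    omega

theorem fnd_le (Z l r) : fnd Z l r ≤ r := Nat.findGreatest_le r

theorem fnd_spec (Z l r) : fnd Z l r = 0 ∨ Z (l+1) (fnd Z l r) < Z l (fnd Z l r - 1) :=
  Nat.findGreatest_spec (P := fun s => s = 0 ∨ Z (l+1) s < Z l (s-1)) (Nat.zero_le r) (Or.inl rfl)

theorem fnd_max (Z l r t) (h1 : fnd Z l r < t) (h2 : t ≤ r) : Z l (t-1) ≤ Z (l+1) t := by
  have := Nat.findGreatest_is_greatest h1 h2
  push Not at this
  exact this.2

theorem fnd_eq (Z l r s) (hs : s ≤ r) (h : s = 0 ∨ Z (l+1) s < Z l (s-1))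
    (h2 : ∀ t, s < t → t ≤ r → Z l (t-1) ≤ Z (l+1) t) : fnd Z l r = s := by
  unfold fnd
  rw [Nat.findGreatest_eq_iff]
  refine ⟨hs, fun _ => h, ?_⟩
  intro t h3 h4
  have := h2 t h3 h4
  omega

theorem fnd_congr {Z Z' : ℕ → ℕ → ℕ} {l : ℕ} (h : ∀ r, Z l r = Z' l r)
    (h' : ∀ r, Z (l+1) r = Z' (l+1) r) (r) : fnd Z l r = fnd Z' l r := by
  unfold fnd
  congr 1
  funext s
  rw [h, h']

theorem rho_of_le (Z a) : ∀ l, l ≤ a → rho Z a l = l := by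
  intro l h
  cases l with
  | zero => rfl
  | succ l => simp [rho, Nat.lt_of_succ_le h]

theorem rho_succ (Z a l) (h : a ≤ l) : rho Z a (l+1) = fnd Z l (rho Z a l) := by
  simp [rho, Nat.not_lt.mpr h]

theorem rho_le (Z a) : ∀ l, rho Z a l ≤ l := by
  intro l
  induction l with
  | zero => simp [rho]
  | succ l ih =>
    by_cases h : l < a
    · simp [rho, h]
    · rw [rho_succ _ _ _ (by omega)]
      have := fnd_le Z l (rho Z a l)
      omega

theorem rho_lt (Z a l) (h : a < l) : rho Z a l < l := by
  obtain ⟨l, rfl⟩ : ∃ r', l = r' + 1 := ⟨l - 1, by omega⟩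
  rw [rho_succ _ _ _ (by omega)]
  have := fnd_le Z l (rho Z a l)
  have := rho_le Z a l
  omega

theorem rho_congr {Z Z' : ℕ → ℕ → ℕ} {k : ℕ} (a) (h : ∀ l, l ≤ k → ∀ r, Z l r = Z' l r) :
    ∀ l, l ≤ k → rho Z a l = rho Z' a l := by
  intro l
  induction l with
  | zero => intro _; rfl
  | succ l ih =>
    intro hl
    by_cases h' : l < a
    · simp [rho, h']
    · rw [rho_succ _ _ _ (by omega), rho_succ _ _ _ (by omega), ih (by omega),
        fnd_congr (h l (by omega)) (h _ hl)]

theorem upd_congr {Z Z' : ℕ → ℕ → ℕ} {k : ℕ} (a) (h : ∀ l, l ≤ k → ∀ r, Z l r = Z' l r) :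
    ∀ l, l ≤ k → ∀ r, upd Z a l r = upd Z' a l r := by
  intro l hl r
  unfold upd
  rw [h l hl, rho_congr a h l hl]

theorem upd_of_le (Z a l r) (h : l ≤ a) : upd Z a l r = Z l r := by
  simp [upd, Nat.not_lt.mpr h]

theorem upd_pat {k Z} (h : PatK k Z) (a) : PatK k (upd Z a) := by
  refine ⟨fun r => by rw [upd_of_le _ _ _ _ (Nat.zero_le _)]; exact h.1 r, ?_⟩
  intro l hl r
  by_cases hal : a ≤ l
  · have hs := rho_succ Z a l hal
    set q := rho Z a l with hq
    have h1 := fnd_le Z l q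
    have h2 := fnd_spec Z l q
    have h3 := fnd_max Z l q
    rw [← hs] at h1 h2 h3
    set s := rho Z a (l+1) with hs'
    constructor
    · have h4 := (h.2 l hl r).1
      unfold upd
      rw [← hq, ← hs']
      by_cases c1 : a < l ∧ r = q
      · obtain ⟨c1, hrq⟩ := c1; subst r
        by_cases c2 : q = s
        · rw [if_pos ⟨c1, rfl⟩, if_pos ⟨by omega, c2⟩]; omega
        · have h5 : Z l q < Z (l+1) q := by
            have h6 := h3 q (by omega) le_rfl
            obtain ⟨l, rfl⟩ : ∃ r', l = r' + 1 := ⟨l - 1, by omega⟩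
            have h7 := rho_succ Z a l (by omega)
            have h8 := fnd_spec Z l (rho Z a l)
            rw [← h7, ← hq] at h8
            have h9 := (h.2 l (by omega) (q-1)).1
            omega
          split_ifs <;> omega
      · rw [if_neg c1]; omega
    · have h4 := (h.2 l hl r).2
      unfold upd
      rw [← hq, ← hs']
      by_cases c1 : r + 1 = s
      · rw [← c1] at h2
        simp at h2
        split_ifs <;> omega
      · split_ifs <;> omega
  · rw [upd_of_le _ _ _ _ (by omega), upd_of_le _ _ _ _ (by omega), upd_of_le _ _ _ _ (by omega)]
    exact h.2 l hl r

theorem Zof_pat (w : ℕ → ℕ) (k n : ℕ) : PatK k (Zof w n) := by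
  induction n with
  | zero => exact ⟨fun _ => rfl, fun _ _ _ => ⟨le_rfl, le_rfl⟩⟩
  | succ n ih => exact upd_pat ih _

theorem Zof_congr {w w' : ℕ → ℕ} (n : ℕ) (h : ∀ m, m < n → w m = w' m) : Zof w n = Zof w' n := by
  induction n with
  | zero => rfl
  | succ n ih =>
    simp only [Zof]
    rw [ih (fun m hm => h m (by omega)), h n (by omega)]

/-! ### The reverse step -/

theorem rho_of_upd {Z Z' : ℕ → ℕ → ℕ} {a k s : ℕ}
    (hup : ∀ r, upd Z a k r = Z' k r) (htop : ∀ r, Z' k r = Z k r + if r = s then 1 else 0) :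
    a < k ∧ rho Z a k = s := by
  have h1 := hup s
  rw [htop s] at h1
  unfold upd at h1
  simp at h1
  exact ⟨h1.1, h1.2.symm⟩

theorem back (k : ℕ) : ∀ (Z' : ℕ → ℕ → ℕ) (s : ℕ), PatK k Z' → Z' k (s+1) < Z' k s →
    ∃ a Z, a < k ∧ PatK k Z ∧ (∀ r, Z' k r = Z k r + if r = s then 1 else 0) ∧
      ∀ l, l ≤ k → ∀ r, upd Z a l r = Z' l r := by
  induction k with
  | zero => intro Z' s h h'; simp [h.1] at h'
  | succ k ih =>
    intro Z' s hP hs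
    have hz := hP.zero
    have hsk : s ≤ k := by
      by_contra hc
      have := hz (k+1) le_rfl s (by omega)
      omega
    have hex : ∃ r, s ≤ r ∧ (k ≤ r ∨ Z' (k+1) (r+1) < Z' k r) := ⟨k, hsk, Or.inl le_rfl⟩
    classical
    obtain ⟨hr1, hr2⟩ := Nat.find_spec hex
    have hr3 : ∀ t, s < t → t ≤ Nat.find hex → Z' k (t-1) ≤ Z' (k+1) t := by
      intro t h1 h2
      have := Nat.find_min hex (m := t-1) (by omega)
      push Not at this
      have h3 := (this (by omega)).2
      rwa [Nat.sub_add_cancel (by omega)] at h3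
    have hr4 : Nat.find hex ≤ k := Nat.find_min' hex ⟨hsk, Or.inl le_rfl⟩
    set q := Nat.find hex
    by_cases hqk : q = k
    · -- the letter is `k`
      let Z : ℕ → ℕ → ℕ := fun l r => if l = k + 1 then Z' l r - (if r = s then 1 else 0) else Z' l r
      have e1 : ∀ l, l ≤ k → ∀ r, Z l r = Z' l r := by
        intro l hl r; simp [Z, show l ≠ k + 1 by omega]
      have e2 : ∀ r, Z' (k+1) r = Z (k+1) r + if r = s then 1 else 0 := by
        intro r; simp only [Z, if_true]
        split_ifs with h
        · subst h; omega
        · omega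
      have hrho : rho Z k (k+1) = s := by
        rw [rho_succ _ _ _ le_rfl, rho_of_le _ _ _ le_rfl]
        apply fnd_eq _ _ _ _ hsk
        · rw [e1 k le_rfl]
          by_cases h0 : s = 0
          · exact Or.inl h0
          · right
            have h5 := e2 s
            have h6 := (hP.2 k (by omega) (s-1)).2
            rw [Nat.sub_add_cancel (by omega)] at h6
            simp at h5; omega
        · intro t h1 h2
          have h5 := e2 t
          rw [if_neg (by omega)] at h5
          rw [e1 k le_rfl]
          have := hr3 t h1 (by omega)
          omega
      refine ⟨k, Z, by omega, ⟨fun r => ?_, ?_⟩, e2, ?_⟩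
      · rw [e1 0 (by omega)]; exact hP.1 r
      · intro l hl r
        have h0 := hP.2 l hl r
        by_cases hlk : l = k
        · subst hlk
          rw [e1 l le_rfl]
          have h5 := e2 r
          have h6 := e2 (r+1)
          have h7 := e2 s
          refine ⟨?_, by split_ifs at h6 <;> omega⟩
          by_cases h8 : r = s
          · subst h8
            by_cases h9 : r = l
            · subst h9
              rw [hz r (by omega) r le_rfl]; omega
            · have := hr3 (r+1) (by omega) (by omega)
              simp at this h5
              omega
          · rw [if_neg h8] at h5; omega
        · rw [e1 l (by omega), e1 (l+1) (by omega), e1 (l+1) (by omega)]; exact h0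
      · intro l hl r
        by_cases hlk : l = k + 1
        · subst hlk
          rw [e2 r]
          simp [upd, hrho]
        · rw [upd_of_le _ _ _ _ (by omega), e1 l (by omega)]
    · have hq2 : Z' (k+1) (q+1) < Z' k q := by omega
      have hq3 := (hP.2 k (by omega) (q+1)).1
      obtain ⟨a, Z0, hak, hP0, htop0, hup0⟩ := ih Z' q (hP.mono (by omega)) (by omega)
      let Z : ℕ → ℕ → ℕ := fun l r => if l = k + 1 then Z' l r - (if r = s then 1 else 0) else Z0 l r
      have e1 : ∀ l, l ≤ k → ∀ r, Z l r = Z0 l r := by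
        intro l hl r; simp [Z, show l ≠ k + 1 by omega]
      have e2 : ∀ r, Z' (k+1) r = Z (k+1) r + if r = s then 1 else 0 := by
        intro r; simp only [Z, if_true]
        split_ifs with h
        · subst h; omega
        · omega
      have hrk : rho Z a k = q := by
        rw [rho_congr a e1 k le_rfl]
        exact (rho_of_upd (hup0 k le_rfl) htop0).2
      have hrho : rho Z a (k+1) = s := by
        rw [rho_succ _ _ _ (by omega), hrk]
        apply fnd_eq _ _ _ _ hr1
        · rw [e1 k le_rfl]
          by_cases h0 : s = 0
          · exact Or.inl h0
          · right
            have h5 := e2 s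
            have h6 := (hP.2 k (by omega) (s-1)).2
            have h7 := htop0 (s-1)
            rw [if_neg (by omega)] at h7
            rw [Nat.sub_add_cancel (by omega)] at h6
            simp at h5; omega
        · intro t h1 h2
          have h5 := e2 t
          rw [if_neg (by omega)] at h5
          rw [e1 k le_rfl]
          have := hr3 t h1 (by omega)
          have h7 := htop0 (t-1)
          omega
      refine ⟨a, Z, by omega, ⟨fun r => ?_, ?_⟩, e2, ?_⟩
      · rw [e1 0 (by omega)]; exact hP0.1 r
      · intro l hl r
        by_cases hlk : l = k
        · subst hlk
          have h0 := hP.2 l hl r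
          rw [e1 l le_rfl]
          have h5 := e2 r
          have h6 := e2 (r+1)
          have h7 := htop0 r
          constructor
          · by_cases h8 : r = s
            · subst h8
              by_cases h9 : r = q
              · rw [if_pos h9] at h7; rw [if_pos rfl] at h5; omega
              · have := hr3 (r+1) (by omega) (by omega)
                simp at this h5
                omega
            · rw [if_neg h8] at h5; omega
          · by_cases h9 : r = q
            · subst h9; rw [if_pos rfl] at h7; omega
            · rw [if_neg h9] at h7; omega
        · rw [e1 l (by omega), e1 (l+1) (by omega), e1 (l+1) (by omega)]
          exact hP0.2 l (by omega) r
      · intro l hl r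
        by_cases hlk : l = k + 1
        · subst hlk
          rw [e2 r]
          simp [upd, hrho, show a < k + 1 by omega]
        · rw [upd_congr a e1 l (by omega), hup0 l (by omega)]

theorem back_unique (k : ℕ) : ∀ (Z' Z₁ Z₂ : ℕ → ℕ → ℕ) (s a₁ a₂ : ℕ),
    PatK k Z₁ → PatK k Z₂ →
    (∀ r, Z' k r = Z₁ k r + if r = s then 1 else 0) →
    (∀ r, Z' k r = Z₂ k r + if r = s then 1 else 0) →
    (∀ l, l ≤ k → ∀ r, upd Z₁ a₁ l r = Z' l r) →
    (∀ l, l ≤ k → ∀ r, upd Z₂ a₂ l r = Z' l r) →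
    a₁ = a₂ ∧ ∀ l, l ≤ k → ∀ r, Z₁ l r = Z₂ l r := by
  induction k with
  | zero =>
    intro Z' Z₁ Z₂ s a₁ a₂ hP₁ hP₂ ht₁ ht₂ hu₁ hu₂
    have := (rho_of_upd (hu₁ 0 le_rfl) ht₁).1
    omega
  | succ k ih =>
    intro Z' Z₁ Z₂ s a₁ a₂ hP₁ hP₂ ht₁ ht₂ hu₁ hu₂
    have key : ∀ (Z : ℕ → ℕ → ℕ) (a : ℕ), PatK (k+1) Z →
        (∀ r, Z' (k+1) r = Z (k+1) r + if r = s then 1 else 0) →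
        (∀ l, l ≤ k+1 → ∀ r, upd Z a l r = Z' l r) →
        s ≤ rho Z a k ∧ (∀ t, s < t → t ≤ rho Z a k → Z' k (t-1) ≤ Z' (k+1) t) ∧
        ((a = k ∧ rho Z a k = k) ∨
          (a < k ∧ rho Z a k < k ∧ Z' (k+1) (rho Z a k + 1) < Z' k (rho Z a k) ∧
            ∀ r, Z' k r = Z k r + if r = rho Z a k then 1 else 0)) := by
      intro Z a hP ht hu
      obtain ⟨h1, h2⟩ := rho_of_upd (hu (k+1) le_rfl) ht
      rw [rho_succ _ _ _ (by omega)] at h2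
      have h3 := fnd_le Z k (rho Z a k)
      have h4 := fnd_max Z k (rho Z a k)
      rw [h2] at h3 h4
      have hk := hu k (by omega)
      refine ⟨h3, ?_, ?_⟩
      · intro t ht1 ht2
        have h5 := h4 t ht1 ht2
        have h6 := ht t
        have h7 := hk (t-1)
        unfold upd at h7
        rw [if_neg (by omega)] at h7
        omega
      · by_cases hak : a = k
        · left; subst hak; exact ⟨rfl, rho_of_le _ _ _ le_rfl⟩
        · right
          have hr : ∀ r, Z' k r = Z k r + if r = rho Z a k then 1 else 0 := by
            intro r
            rw [← hk r]; simp [upd, show a < k by omega]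
          refine ⟨by omega, rho_lt _ _ _ (by omega), ?_, hr⟩
          have h5 := hr (rho Z a k)
          have h6 := ht (rho Z a k + 1)
          have h7 := (hP.2 k (by omega) (rho Z a k)).2
          rw [if_neg (by omega)] at h6
          simp at h5
          omega
    obtain ⟨b1, b2, b3⟩ := key Z₁ a₁ hP₁ ht₁ hu₁
    obtain ⟨c1, c2, c3⟩ := key Z₂ a₂ hP₂ ht₂ hu₂
    have hreq : rho Z₁ a₁ k = rho Z₂ a₂ k := by
      rcases lt_trichotomy (rho Z₁ a₁ k) (rho Z₂ a₂ k) with h | h | h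
      · exfalso
        have := c2 (rho Z₁ a₁ k + 1) (by omega) (by omega)
        simp at this
        have := rho_le Z₂ a₂ k
        omega
      · exact h
      · exfalso
        have := b2 (rho Z₂ a₂ k + 1) (by omega) (by omega)
        simp at this
        have := rho_le Z₁ a₁ k
        omega
    have htop : ∀ r, Z₁ (k+1) r = Z₂ (k+1) r := by
      intro r
      have h1 := ht₁ r
      have h2 := ht₂ r
      omega
    have hrest : a₁ = a₂ ∧ ∀ l, l ≤ k → ∀ r, Z₁ l r = Z₂ l r := by
      rcases b3 with ⟨b3, b4⟩ | ⟨b3, b4, b5, b6⟩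
      · have ha : a₂ = k := by omega
        subst b3
        refine ⟨ha.symm, fun l hl r => ?_⟩
        have h1 := hu₁ l (by omega) r
        have h2 := hu₂ l (by omega) r
        rw [upd_of_le _ _ _ _ (by omega)] at h1 h2
        omega
      · rcases c3 with ⟨c3, c4⟩ | ⟨c3, c4, c5, c6⟩
        · omega
        · rw [← hreq] at c6
          exact ih Z' Z₁ Z₂ _ a₁ a₂ (hP₁.mono (by omega)) (hP₂.mono (by omega)) b6 c6
            (fun l hl => hu₁ l (by omega)) (fun l hl => hu₂ l (by omega))
    refine ⟨hrest.1, fun l hl r => ?_⟩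
    by_cases h : l = k + 1
    · subst h; exact htop r
    · exact hrest.2 l (by omega) r

/-! ### The transformation `G` in terms of patterns -/

theorem minOp_zero (x y) : minOp x y 0 = x 0 := by simp [minOp]

theorem minOp_succ (x y : ℕ → ℤ) (n) :
    minOp x y (n+1) = min (minOp x y n + (y (n+1) - y n)) (x (n+1)) := by
  unfold minOp
  apply le_antisymm
  · rw [le_min_iff]
    constructor
    · rw [← sub_le_iff_le_add, Finset.le_inf'_iff]
      intro m hm
      have := Finset.inf'_le (s := Finset.range (n+1+1)) (fun m => x m + y (n+1) - y m)
        (b := m) (by simp at hm ⊢; omega)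
      linarith
    · have := Finset.inf'_le (s := Finset.range (n+1+1)) (fun m => x m + y (n+1) - y m)
        (b := n+1) (by simp)
      linarith
  · rw [Finset.le_inf'_iff]
    intro m hm
    by_cases h : m = n + 1
    · subst h
      have := min_le_right ((Finset.range (n+1)).inf' (by simp) (fun m => x m + y n - y m)
        + (y (n+1) - y n)) (x (n+1))
      linarith
    · have := Finset.inf'_le (s := Finset.range (n+1)) (fun m => x m + y n - y m)
        (b := m) (by simp at hm ⊢; omega)
      have h2 := min_le_left ((Finset.range (n+1)).inf' (by simp) (fun m => x m + y n - y m)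
        + (y (n+1) - y n)) (x (n+1))
      linarith

theorem maxOp_zero (x y) : maxOp x y 0 = x 0 := by simp [maxOp]

theorem maxOp_succ (x y : ℕ → ℤ) (n) :
    maxOp x y (n+1) = max (maxOp x y n + (y (n+1) - y n)) (x (n+1)) := by
  unfold maxOp
  apply le_antisymm
  · rw [Finset.sup'_le_iff]
    intro m hm
    by_cases h : m = n + 1
    · subst h
      have := le_max_right ((Finset.range (n+1)).sup' (by simp) (fun m => x m + y n - y m)
        + (y (n+1) - y n)) (x (n+1))
      linarith
    · have := Finset.le_sup' (s := Finset.range (n+1)) (fun m => x m + y n - y m)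
        (b := m) (by simp at hm ⊢; omega)
      have h2 := le_max_left ((Finset.range (n+1)).sup' (by simp) (fun m => x m + y n - y m)
        + (y (n+1) - y n)) (x (n+1))
      linarith
  · rw [max_le_iff]
    constructor
    · rw [← le_sub_iff_add_le, Finset.sup'_le_iff]
      intro m hm
      have := Finset.le_sup' (s := Finset.range (n+1+1)) (fun m => x m + y (n+1) - y m)
        (b := m) (by simp at hm ⊢; omega)
      linarith
    · have := Finset.le_sup' (s := Finset.range (n+1+1)) (fun m => x m + y (n+1) - y m)
        (b := n+1) (by simp)
      linarith

theorem maxOp_eq (x y : ℕ → ℤ) (h0 : y 0 = 0) (n) : maxOp x y n = x n + y n - minOp y x n := by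
  induction n with
  | zero => simp [maxOp_zero, minOp_zero, h0]
  | succ n ih => rw [maxOp_succ, minOp_succ, ih]; omega

/-- The carry when a new walk `u` is inserted in the rows `A`. -/
noncomputable def carry (A : ℕ → ℕ → ℤ) (u : ℕ → ℤ) : ℕ → (ℕ → ℤ)
  | 0 => u
  | i+1 => maxOp (carry A u i) (A i)

theorem carry_shift (A : ℕ → ℕ → ℤ) (u) (i) :
    carry A u (i+1) = carry (fun j => A (j+1)) (maxOp u (A 0)) i := by
  induction i with
  | zero => rfl
  | succ i ih => rw [carry, ih]; rfl

theorem G_row (k : ℕ) : ∀ x : ℕ → ℕ → ℤ,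
    (∀ i, i < k + 1 → G (k+2) x i = minOp (G (k+1) x i) (carry (G (k+1) x) (x (k+1)) i)) ∧
    G (k+2) x (k+1) = carry (G (k+1) x) (x (k+1)) (k+1) := by
  induction k with
  | zero =>
    intro x
    refine ⟨fun i hi => ?_, rfl⟩
    obtain rfl : i = 0 := by omega
    rfl
  | succ k ih =>
    intro x
    obtain ⟨h1, h2⟩ := ih (Tseq x)
    have e : ∀ i, carry (G (k+2) x) (x (k+2)) (i+1)
        = carry (G (k+1) (Tseq x)) (Tseq x (k+1)) i := by
      intro i; rw [carry_shift]; rfl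
    constructor
    · intro i hi
      cases i with
      | zero => rfl
      | succ i =>
        show G (k+2) (Tseq x) i = _
        rw [h1 i (by omega)]
        rw [show k + 1 + 1 = k + 2 from rfl, e]
        rfl
    · show G (k+2) (Tseq x) (k+1) = _
      rw [h2, ← e]

def cnt (w : ℕ → ℕ) (i n : ℕ) : ℤ := (((Finset.range n).filter (fun m => w m = i)).card : ℤ)

theorem cnt_succ (w i n) : cnt w i (n+1) = cnt w i n + if w n = i then 1 else 0 := by
  unfold cnt
  rw [Finset.range_add_one, Finset.filter_insert]
  split_ifs <;> simp

theorem carry_eq (w : ℕ → ℕ) (l : ℕ) (A : ℕ → ℕ → ℤ)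
    (hA : ∀ i, i < l → ∀ n, A i n = (Zof w n l (l-1-i) : ℤ)) :
    ∃ U : ℕ → ℕ → ℤ, (∀ i, i ≤ l → carry A (cnt w l) i = U i) ∧
      (∀ i, i < l → minOp (A i) (U i) = fun n => (Zof w n (l+1) (l-i) : ℤ)) ∧
      U l = fun n => (Zof w n (l+1) 0 : ℤ) := by
  let D : ℕ → ℕ → ℤ := fun i n =>
    if w n ≤ l ∧ rho (Zof w n) (w n) (l+1) ≤ l - i ∧ l - i ≤ rho (Zof w n) (w n) l then 1 else 0
  let U : ℕ → ℕ → ℤ := fun i n => ∑ m ∈ Finset.range n, D i m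
  have U0 : ∀ i, U i 0 = 0 := fun i => by simp [U]
  have US : ∀ i n, U i (n+1) = U i n + D i n := fun i n => by simp [U, Finset.sum_range_succ]
  have hmin : ∀ i, i < l → minOp (A i) (U i) = fun n => (Zof w n (l+1) (l-i) : ℤ) := by
    intro i hi
    funext n
    induction n with
    | zero => rw [minOp_zero, hA i hi]; rfl
    | succ n ih =>
      rw [minOp_succ, ih, US, hA i hi]
      simp only [D, Zof]
      have hP := Zof_pat w (l+1) n
      set Z := Zof w n
      set a := w n
      obtain ⟨t, ht⟩ : ∃ t, l - i = t + 1 := ⟨l - i - 1, by omega⟩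
      rw [ht, show l - 1 - i = t by omega]
      have hPt := (hP.2 l (by omega) t).2
      by_cases hal : a ≤ l
      · have hs := rho_succ Z a l hal
        have h1 := fnd_le Z l (rho Z a l)
        have h2 := fnd_spec Z l (rho Z a l)
        have h3 := fnd_max Z l (rho Z a l) (t+1)
        rw [← hs] at h1 h2 h3
        unfold upd
        set s := rho Z a (l+1)
        set q := rho Z a l
        simp only [Nat.add_sub_cancel] at h3
        by_cases c1 : s ≤ t + 1 ∧ t + 1 ≤ q
        · rw [if_pos ⟨hal, c1⟩, if_neg (show ¬ (a < l ∧ t = q) by omega)]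
          by_cases c2 : t + 1 = s
          · rw [if_pos ⟨by omega, c2⟩]
            rw [← c2] at h2
            simp at h2
            push_cast; omega
          · rw [if_neg (by omega)]
            have := h3 (by omega) (by omega)
            push_cast; omega
        · rw [if_neg (by omega), if_neg (show ¬ (a < l + 1 ∧ t + 1 = s) by omega)]
          split_ifs <;> push_cast <;> omega
      · rw [if_neg (by omega), upd_of_le _ _ _ _ (by omega), upd_of_le _ _ _ _ (by omega)]
        omega
  refine ⟨U, ?_, hmin, ?_⟩
  · intro i
    induction i with
    | zero =>
      intro _
      funext n
      simp only [carry]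
      induction n with
      | zero => simp [U0, cnt]
      | succ n ih =>
        rw [cnt_succ, US, ih]
        congr 1
        simp only [D]
        have h1 := rho_le (Zof w n) (w n) l
        have h2 := rho_lt (Zof w n) (w n) l
        have h3 := rho_lt (Zof w n) (w n) (l+1)
        have h4 := rho_of_le (Zof w n) (w n) l
        congr 1
        apply propext
        omega
    | succ i ih =>
      intro hi
      rw [carry, ih (by omega)]
      have hA0 : A i 0 = 0 := by rw [hA i (by omega)]; rfl
      funext n
      rw [maxOp_eq _ _ hA0, hmin i (by omega), hA i (by omega)]
      simp only
      induction n with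
      | zero => simp [U0, Zof]
      | succ n ih' =>
        rw [US, US, ← ih']
        simp only [D, Zof]
        set Z := Zof w n
        set a := w n
        obtain ⟨t, ht⟩ : ∃ t, l - i = t + 1 := ⟨l - i - 1, by omega⟩
        rw [ht, show l - 1 - i = t by omega, show l - (i+1) = t by omega]
        unfold upd
        by_cases hal : a ≤ l
        · have hs := rho_succ Z a l hal
          have h1 := fnd_le Z l (rho Z a l)
          have h4 := rho_of_le Z a l
          rw [← hs] at h1
          set s := rho Z a (l+1)
          set q := rho Z a l
          push_cast
          split_ifs <;> omega
        · rw [if_neg (by omega), if_neg (by omega), if_neg (by omega), if_neg (by omega)]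
          push_cast; omega
  · funext n
    induction n with
    | zero => simp [U0, Zof]
    | succ n ih =>
      rw [US, ih]
      simp only [D, Zof, upd]
      push_cast
      congr 1
      congr 1
      apply propext
      omega

theorem G_eq (w : ℕ → ℕ) (k : ℕ) : ∀ i, i < k + 1 →
    G (k+1) (cnt w) i = fun n => (Zof w n (k+1) (k-i) : ℤ) := by
  induction k with
  | zero =>
    intro i hi
    obtain rfl : i = 0 := by omega
    obtain ⟨U, h1, h2, h3⟩ := carry_eq w 0 (fun _ _ => 0) (by intro i hi; omega)
    show cnt w 0 = _
    have := h1 0 le_rfl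
    rw [h3] at this
    exact this
  | succ k ih =>
    intro i hi
    obtain ⟨U, h1, h2, h3⟩ := carry_eq w (k+1) (G (k+1) (cnt w)) (by
      intro i hi n
      rw [ih i hi]; simp)
    obtain ⟨g1, g2⟩ := G_row k (cnt w)
    by_cases hik : i < k + 1
    · rw [show k + 1 + 1 = k + 2 from rfl, g1 i hik, h1 i (by omega), h2 i hik]
    · obtain rfl : i = k + 1 := by omega
      rw [show k + 1 + 1 = k + 2 from rfl, g2, h1 _ le_rfl, h3]; simp

/-! ### Patterns and tableaux -/

def ZT (lam : ℕ → ℕ) (T : ℕ → ℕ → ℕ) (l r : ℕ) : ℕ :=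
  ((Finset.range (lam r)).filter (fun c => T r c < l)).card

theorem mem_iff_lt_card (S : Finset ℕ) (h : ∀ c c', c ≤ c' → c' ∈ S → c ∈ S) (c : ℕ) :
    c < S.card ↔ c ∈ S := by
  constructor
  · intro hc
    by_contra hn
    have : S ⊆ Finset.range c := by
      intro d hd
      rw [Finset.mem_range]
      by_contra h'
      exact hn (h c d (by omega) hd)
    have := Finset.card_le_card this
    rw [Finset.card_range] at this
    omega
  · intro hc
    have : Finset.range (c+1) ⊆ S := by
      intro d hd
      rw [Finset.mem_range] at hd
      exact h d c (by omega) hc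
    have := Finset.card_le_card this
    rw [Finset.card_range] at this
    omega

theorem lt_ZT {k lam T} (hT : IsSSYT k lam T) (l r c) : c < ZT lam T l r ↔ c < lam r ∧ T r c < l := by
  unfold ZT
  rw [mem_iff_lt_card, Finset.mem_filter, Finset.mem_range]
  intro c c' hcc h
  rw [Finset.mem_filter, Finset.mem_range] at h ⊢
  have := hT.2.2.1 r c c' hcc h.1
  omega

theorem le_of_forall_lt_nat {a b : ℕ} (h : ∀ c, c < a → c < b) : a ≤ b := by
  by_contra hc
  have := h b (by omega)
  omega

theorem ZT_top {k lam T} (hT : IsSSYT k lam T) (r) : ZT lam T k r = lam r := by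
  apply le_antisymm <;> apply le_of_forall_lt_nat <;> intro c hc
  · exact ((lt_ZT hT k r c).1 hc).1
  · exact (lt_ZT hT k r c).2 ⟨hc, hT.1 r c hc⟩

theorem ZT_pat {k lam T} (hT : IsSSYT k lam T) (hl : ∀ r, lam (r+1) ≤ lam r) :
    PatK k (ZT lam T) := by
  refine ⟨fun r => by simp [ZT], fun l _ r => ⟨?_, ?_⟩⟩ <;> apply le_of_forall_lt_nat <;>
    intro c hc <;> rw [lt_ZT hT] at hc ⊢
  · omega
  · have := hT.2.2.2 r (r+1) c (by omega) hc.1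
    have := hl r
    omega

theorem PatK.mono_level {k Z} (h : PatK k Z) (r : ℕ) {l l' : ℕ} (hl : l ≤ l') (hk : l' ≤ k) :
    Z l r ≤ Z l' r := by
  induction l', hl using Nat.le_induction with
  | base => exact le_rfl
  | succ m _ ih =>
    have h1 := ih (by omega)
    have h2 := (h.2 m (by omega) r).1
    omega

theorem PatK.anti {k Z} (h : PatK k Z) {l : ℕ} (hk : l ≤ k) {r r' : ℕ} (hr : r ≤ r') :
    Z l r' ≤ Z l r := by
  induction r', hr using Nat.le_induction with
  | base => exact le_rfl
  | succ m _ ih =>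
    cases l with
    | zero => rw [h.1, h.1]
    | succ l =>
      have h1 := h.2 l (by omega) m
      omega

theorem ZT_surj {k lam Z} (hZ : PatK k Z) (htop : ∀ r, Z k r = lam r) :
    ∃ T, IsSSYT k lam T ∧ ∀ l, l ≤ k → ∀ r, ZT lam T l r = Z l r := by
  classical
  let T : ℕ → ℕ → ℕ := fun r c =>
    if h : ∃ l, l < k ∧ c < Z (l+1) r then Nat.find h else 0
  have key : ∀ r c, c < lam r → ∀ l, l ≤ k → (T r c < l ↔ c < Z l r) := by
    intro r c hc l hl
    have hk : 0 < k := by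
      by_contra h
      obtain rfl : k = 0 := by omega
      rw [← htop, hZ.1] at hc
      omega
    have h : ∃ l, l < k ∧ c < Z (l+1) r :=
      ⟨k - 1, by omega, by rw [Nat.sub_add_cancel hk, htop]; exact hc⟩
    simp only [T, dif_pos h]
    constructor
    · intro h1
      have h2 := (Nat.find_spec h).2
      have h3 := hZ.mono_level r (show Nat.find h + 1 ≤ l by omega) hl
      omega
    · intro h1
      cases l with
      | zero => rw [hZ.1] at h1; omega
      | succ l =>
        have := Nat.find_min' h (m := l) ⟨by omega, h1⟩
        omega
  have hT : IsSSYT k lam T := by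
    refine ⟨?_, ?_, ?_, ?_⟩
    · intro r c hc
      rw [key r c hc k le_rfl, htop]; exact hc
    · intro r c hc
      have : ¬ ∃ l, l < k ∧ c < Z (l+1) r := by
        rintro ⟨l, hl, h⟩
        have := hZ.mono_level r (show l + 1 ≤ k by omega) le_rfl
        rw [htop] at this
        omega
      simp only [T, dif_neg this]
    · intro r c c' hcc hc'
      have h1 : T r c' < k := by rw [key r c' hc' k le_rfl, htop]; exact hc'
      have h2 := (key r c' hc' (T r c' + 1) (by omega)).1 (by omega)
      have h3 := (key r c (by omega) (T r c' + 1) (by omega)).2 (by omega)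
      omega
    · intro r r' c hr hc
      have h1 : T r' c < k := by rw [key r' c hc k le_rfl, htop]; exact hc
      have h2 := (key r' c hc (T r' c + 1) (by omega)).1 (by omega)
      have h3 := hZ.anti (show T r' c + 1 ≤ k by omega) (show r + 1 ≤ r' from hr)
      have h4 := (hZ.2 (T r' c) h1 r).2
      have h5 := hZ.anti (le_refl k) (show r ≤ r' by omega)
      rw [htop, htop] at h5
      exact (key r c (by omega) (T r' c) (by omega)).2 (by omega)
  refine ⟨T, hT, fun l hl r => ?_⟩
  have hle := hZ.mono_level r hl le_rfl
  rw [htop] at hle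
  apply le_antisymm <;> apply le_of_forall_lt_nat <;> intro c hc
  · rw [lt_ZT hT] at hc
    exact (key r c hc.1 l hl).1 hc.2
  · rw [lt_ZT hT]
    exact ⟨by omega, (key r c (by omega) l hl).2 hc⟩

theorem ZT_inj {k lam T T'} (hT : IsSSYT k lam T) (hT' : IsSSYT k lam T')
    (h : ∀ l, l ≤ k → ∀ r, ZT lam T l r = ZT lam T' l r) : T = T' := by
  funext r c
  by_cases hc : c < lam r
  · have key : ∀ l, l ≤ k → (T r c < l ↔ T' r c < l) := by
      intro l hl
      have h1 := lt_ZT hT l r c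
      have h2 := lt_ZT hT' l r c
      rw [h l hl r, h2] at h1
      tauto
    have a1 := hT.1 r c hc
    have a2 := hT'.1 r c hc
    have a3 := key (T r c) (by omega)
    have a4 := key (T' r c) (by omega)
    omega
  · rw [hT.2.1 r c hc, hT'.2.1 r c hc]

def wt (k : ℕ) (Z : ℕ → ℕ → ℕ) (l : ℕ) : ℕ :=
  (∑ r ∈ Finset.range k, Z (l+1) r) - ∑ r ∈ Finset.range k, Z l r

theorem wt_ZT (k lam T l) : wt k (ZT lam T) l = entryCount k lam T l := by
  have h : entryCount k lam T l = ∑ r ∈ Finset.range k,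
      ((Finset.range (lam r)).filter (fun c => T r c = l)).card := by
    unfold entryCount cells
    rw [Finset.filter_filter, Finset.card_filter, Finset.sum_product]
    apply Finset.sum_congr rfl
    intro r hr
    rw [← Finset.card_filter]
    congr 1
    ext c
    have := Finset.le_sup (f := lam) hr
    simp only [Finset.mem_filter, Finset.mem_range]
    omega
  have h2 : ∀ r, ZT lam T (l+1) r
      = ZT lam T l r + ((Finset.range (lam r)).filter (fun c => T r c = l)).card := by
    intro r
    unfold ZT
    rw [← Finset.card_union_of_disjoint]
    · congr 1
      ext c
      simp only [Finset.mem_filter, Finset.mem_range, Finset.mem_union]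
      omega
    · rw [Finset.disjoint_filter]
      intro c _ h1
      omega
  unfold wt
  rw [h, Finset.sum_congr rfl (fun r _ => h2 r), Finset.sum_add_distrib]
  omega

theorem finite_SSYT (k : ℕ) (lam : ℕ → ℕ) (h : ∀ r, k ≤ r → lam r = 0) :
    Finite {T : ℕ → ℕ → ℕ // IsSSYT k lam T} := by
  let f : {T : ℕ → ℕ → ℕ // IsSSYT k lam T} → ((r : Fin k) → Fin (lam r) → Fin k) :=
    fun T r c => ⟨T.1 r c, T.2.1 r c c.2⟩
  apply Finite.of_injective f
  intro T T' hTT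
  apply Subtype.ext
  funext r c
  by_cases hc : c < lam r
  · have hr : r < k := by
      by_contra hr
      rw [h r (by omega)] at hc
      omega
    have := congrFun (congrFun hTT ⟨r, hr⟩) ⟨c, hc⟩
    simpa [f] using this
  · rw [T.2.2.1 r c hc, T'.2.2.1 r c hc]

/-! ### Probability -/

theorem wt_upd {k Z} (hP : PatK k Z) {a l : ℕ} (hl : l < k) :
    wt k (upd Z a) l = wt k Z l + if l = a then 1 else 0 := by
  have key : ∀ l, l ≤ k → ∑ r ∈ Finset.range k, upd Z a l r
      = ∑ r ∈ Finset.range k, Z l r + if a < l then 1 else 0 := by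
    intro l hl
    simp only [upd]
    rw [Finset.sum_add_distrib]
    congr 1
    by_cases h : a < l
    · have h1 := rho_lt Z a l h
      simp [h]; omega
    · simp [h]
  unfold wt
  rw [key l (by omega), key (l+1) (by omega)]
  have : ∑ r ∈ Finset.range k, Z l r ≤ ∑ r ∈ Finset.range k, Z (l+1) r :=
    Finset.sum_le_sum (fun r _ => (hP.2 l hl r).1)
  split_ifs <;> omega

theorem prob_pattern {Ω : Type*} [MeasureSpace Ω] [IsProbabilityMeasure (ℙ : Measure Ω)]
    (k : ℕ) (p : ℕ → ℝ)
    (hp0 : ∀ i, i < k → 0 ≤ p i)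
    (ξ : ℕ → Ω → ℕ) (hmeas : ∀ m, Measurable (ξ m))
    (hindep : iIndepFun ξ ℙ)
    (hlaw : ∀ m i, i < k → ℙ {ω | ξ m ω = i} = ENNReal.ofReal (p i))
    (lam : ℕ → ℕ → ℕ) (h0 : ∀ r, lam 0 r = 0) (n : ℕ) :
    (∀ m, m < n → ∃ s, ∀ r, lam (m+1) r = lam m r + if r = s then 1 else 0) →
    (∀ m, m ≤ n → ∀ r, lam m (r+1) ≤ lam m r) →
    ∀ Z, PatK k Z → (∀ r, Z k r = lam n r) →
    ℙ {ω | (∀ m, m ≤ n → ∀ r, Zof (fun j => ξ j ω) m k r = lam m r) ∧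
        ∀ l, l ≤ k → ∀ r, Zof (fun j => ξ j ω) n l r = Z l r}
      = ENNReal.ofReal (∏ l ∈ Finset.range k, p l ^ wt k Z l) := by
  induction n with
  | zero =>
    intro _ _ Z hZ htop
    have hz : ∀ l, l ≤ k → ∀ r, Z l r = 0 := by
      intro l hl r
      have := hZ.mono_level r hl le_rfl
      rw [htop, h0] at this
      omega
    have e : {ω | (∀ m, m ≤ 0 → ∀ r, Zof (fun j => ξ j ω) m k r = lam m r) ∧
        ∀ l, l ≤ k → ∀ r, Zof (fun j => ξ j ω) 0 l r = Z l r} = Set.univ := by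
      ext ω
      simp only [Set.mem_ofPred_eq, Set.mem_univ, iff_true]
      refine ⟨fun m hm r => ?_, fun l hl r => ?_⟩
      · obtain rfl : m = 0 := by omega
        rw [h0]; rfl
      · rw [hz l hl]; rfl
    rw [e, measure_univ, Finset.prod_eq_one, ENNReal.ofReal_one]
    intro l hl
    rw [Finset.mem_range] at hl
    simp [wt, hz l (by omega), hz (l+1) (by omega)]
  | succ n ih =>
    intro hstep hW Z' hZ' htop'
    obtain ⟨s, hs⟩ := hstep n (by omega)
    have hlt : Z' k (s+1) < Z' k s := by
      rw [htop', htop', hs, hs]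
      have := hW n (by omega) s
      simp; omega
    obtain ⟨a, Z, hak, hZ, htop, hup⟩ := back k Z' s hZ' hlt
    have htopn : ∀ r, Z k r = lam n r := by
      intro r
      have h1 := htop r
      rw [htop', hs r] at h1
      omega
    have hI := ih (fun m hm => hstep m (by omega)) (fun m hm => hW m (by omega)) Z hZ htopn
    have hev : {ω | (∀ m, m ≤ n+1 → ∀ r, Zof (fun j => ξ j ω) m k r = lam m r) ∧
          ∀ l, l ≤ k → ∀ r, Zof (fun j => ξ j ω) (n+1) l r = Z' l r}
        = {ω | (∀ m, m ≤ n → ∀ r, Zof (fun j => ξ j ω) m k r = lam m r) ∧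
          ∀ l, l ≤ k → ∀ r, Zof (fun j => ξ j ω) n l r = Z l r} ∩ {ω | ξ n ω = a} := by
      ext ω
      simp only [Set.mem_ofPred_eq, Set.mem_inter_iff]
      constructor
      · rintro ⟨h1, h2⟩
        obtain ⟨u1, u2⟩ := back_unique k Z' (Zof (fun j => ξ j ω) n) Z s (ξ n ω) a
          (Zof_pat _ _ _) hZ (by
            intro r
            rw [htop', hs, h1 n (by omega)]) htop h2 hup
        exact ⟨⟨fun m hm => h1 m (by omega), u2⟩, u1⟩
      · rintro ⟨⟨h1, h2⟩, h3⟩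
        have h4 : ∀ l, l ≤ k → ∀ r, Zof (fun j => ξ j ω) (n+1) l r = Z' l r := by
          intro l hl r
          rw [← hup l hl r]
          simp only [Zof, h3]
          exact upd_congr a h2 l hl r
        refine ⟨fun m hm r => ?_, h4⟩
        by_cases hmn : m = n + 1
        · subst hmn
          rw [h4 k le_rfl, htop']
        · exact h1 m (by omega) r
    rw [hev]
    have hind := hindep.indepFun_finset (Finset.range n) {n} (by simp) hmeas
    let ext : ((i : Finset.range n) → ℕ) → ℕ → ℕ := fun v m =>
      if h : m ∈ Finset.range n then v ⟨m, h⟩ else 0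
    let A : Set ((i : Finset.range n) → ℕ) :=
      {v | (∀ m, m ≤ n → ∀ r, Zof (ext v) m k r = lam m r) ∧
          ∀ l, l ≤ k → ∀ r, Zof (ext v) n l r = Z l r}
    let B : Set ((i : ({n} : Finset ℕ)) → ℕ) := {v | v ⟨n, by simp⟩ = a}
    have hA : {ω | (∀ m, m ≤ n → ∀ r, Zof (fun j => ξ j ω) m k r = lam m r) ∧
          ∀ l, l ≤ k → ∀ r, Zof (fun j => ξ j ω) n l r = Z l r}
        = (fun ω (i : Finset.range n) => ξ i ω) ⁻¹' A := by
      ext ω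
      have hz : ∀ m, m ≤ n → Zof (fun j => ξ j ω) m
          = Zof (ext (fun (i : Finset.range n) => ξ i ω)) m := by
        intro m hm
        apply Zof_congr
        intro j hj
        simp [ext, show j < n by omega]
      simp only [Set.mem_ofPred_eq, Set.mem_preimage, A]
      rw [hz n le_rfl]
      refine and_congr_left' (forall_congr' fun m => forall_congr' fun hm => ?_)
      rw [hz m hm]
    have hB : {ω | ξ n ω = a} = (fun ω (i : ({n} : Finset ℕ)) => ξ i ω) ⁻¹' B := by
      ext ω; simp [B]
    have hmul := hind.measure_inter_preimage_eq_mul A B (Set.to_countable A).measurableSet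
      (measurableSet_eq_fun (measurable_pi_apply _) measurable_const)
    rw [← hA, ← hB] at hmul
    rw [hmul, hI, hlaw n a hak, ← ENNReal.ofReal_mul]
    · congr 1
      have : ∀ l ∈ Finset.range k, p l ^ wt k Z' l
          = p l ^ wt k Z l * (if l = a then p l else 1) := by
        intro l hl
        rw [Finset.mem_range] at hl
        have e : wt k Z' l = wt k (upd Z a) l := by
          unfold wt
          simp only [hup l (by omega), hup (l+1) (by omega)]
        rw [e, wt_upd hZ hl]
        split_ifs
        · rw [pow_succ]
        · simp
      rw [Finset.prod_congr rfl this, Finset.prod_mul_distrib, Finset.prod_ite_eq']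
      simp [hak]
    · apply Finset.prod_nonneg
      intro l hl
      exact pow_nonneg (hp0 l (Finset.mem_range.1 hl)) _

theorem prob_path {Ω : Type*} [MeasureSpace Ω] [IsProbabilityMeasure (ℙ : Measure Ω)]
    (k : ℕ) (p : ℕ → ℝ)
    (hp0 : ∀ i, i < k → 0 ≤ p i)
    (ξ : ℕ → Ω → ℕ) (hmeas : ∀ m, Measurable (ξ m))
    (hindep : iIndepFun ξ ℙ)
    (hlaw : ∀ m i, i < k → ℙ {ω | ξ m ω = i} = ENNReal.ofReal (p i))
    (lam : ℕ → ℕ → ℕ) (h0 : ∀ r, lam 0 r = 0) (n : ℕ)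
    (hstep : ∀ m, m < n → ∃ s, ∀ r, lam (m+1) r = lam m r + if r = s then 1 else 0)
    (hW : ∀ m, m ≤ n → ∀ r, lam m (r+1) ≤ lam m r)
    (hfin : ∀ r, k ≤ r → lam n r = 0) :
    ℙ {ω | ∀ m, m ≤ n → ∀ r, Zof (fun j => ξ j ω) m k r = lam m r}
      = ENNReal.ofReal (schur k (lam n) p) := by
  have := finite_SSYT k (lam n) hfin
  have hZm : ∀ m l r, Measurable (fun ω => Zof (fun j => ξ j ω) m l r) := by
    intro m l r
    have : (fun ω => Zof (fun j => ξ j ω) m l r) =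
        (fun v : (Finset.range m → ℕ) =>
          Zof (fun j => if h : j ∈ Finset.range m then v ⟨j, h⟩ else 0) m l r) ∘
        (fun ω (i : Finset.range m) => ξ i ω) := by
      funext ω
      simp only [Function.comp]
      rw [Zof_congr m]
      intro j hj
      simp [hj]
    rw [this]
    exact (measurable_of_countable _).comp (measurable_pi_lambda _ (fun i => hmeas i))
  have hev : {ω | ∀ m, m ≤ n → ∀ r, Zof (fun j => ξ j ω) m k r = lam m r}
      = ⋃ T : {T : ℕ → ℕ → ℕ // IsSSYT k (lam n) T},
        {ω | (∀ m, m ≤ n → ∀ r, Zof (fun j => ξ j ω) m k r = lam m r) ∧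
        ∀ l, l ≤ k → ∀ r, Zof (fun j => ξ j ω) n l r = ZT (lam n) T.1 l r} := by
    ext ω
    simp only [Set.mem_ofPred_eq, Set.mem_iUnion]
    constructor
    · intro h
      obtain ⟨T, hT, hTZ⟩ := ZT_surj (Zof_pat (fun j => ξ j ω) k n) (h n le_rfl)
      exact ⟨⟨T, hT⟩, h, fun l hl r => (hTZ l hl r).symm⟩
    · rintro ⟨T, h, _⟩
      exact h
  rw [hev, measure_iUnion]
  · have := Fintype.ofFinite {T : ℕ → ℕ → ℕ // IsSSYT k (lam n) T}
    unfold schur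
    rw [tsum_fintype, tsum_fintype, ENNReal.ofReal_sum_of_nonneg]
    · apply Finset.sum_congr rfl
      intro T _
      rw [prob_pattern k p hp0 ξ hmeas hindep hlaw lam h0 n hstep hW _
        (ZT_pat T.2 (hW n le_rfl)) (ZT_top T.2)]
      simp only [wt_ZT]
    · intro T _
      apply Finset.prod_nonneg
      intro l hl
      exact pow_nonneg (hp0 l (Finset.mem_range.1 hl)) _
  · intro T T' hne
    rw [Function.onFun, Set.disjoint_left]
    rintro ω ⟨_, h1⟩ ⟨_, h2⟩
    apply hne
    apply Subtype.ext
    apply ZT_inj T.2 T'.2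
    intro l hl r
    rw [← h1 l hl r, h2 l hl r]
  · intro T
    have hm : ∀ m l r c, MeasurableSet {ω | Zof (fun j => ξ j ω) m l r = c} := fun m l r c =>
      hZm m l r (measurableSet_singleton c)
    have e : {ω | (∀ m, m ≤ n → ∀ r, Zof (fun j => ξ j ω) m k r = lam m r) ∧
        ∀ l, l ≤ k → ∀ r, Zof (fun j => ξ j ω) n l r = ZT (lam n) T.1 l r}
        = (⋂ m, ⋂ (_ : m ≤ n), ⋂ r, {ω | Zof (fun j => ξ j ω) m k r = lam m r}) ∩
          (⋂ l, ⋂ (_ : l ≤ k), ⋂ r, {ω | Zof (fun j => ξ j ω) n l r = ZT (lam n) T.1 l r}) := by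
      ext ω
      simp only [Set.mem_inter_iff, Set.mem_iInter, Set.mem_ofPred_eq]
    rw [e]
    exact MeasurableSet.inter
      (MeasurableSet.iInter fun m => MeasurableSet.iInter fun _ =>
        MeasurableSet.iInter fun r => hm _ _ _ _)
      (MeasurableSet.iInter fun m => MeasurableSet.iInter fun _ =>
        MeasurableSet.iInter fun r => hm _ _ _ _)

theorem prob_G {Ω : Type*} [MeasureSpace Ω] [IsProbabilityMeasure (ℙ : Measure Ω)]
    (k : ℕ) (hk : 2 ≤ k) (p : ℕ → ℝ)
    (hp0 : ∀ i, i < k → 0 ≤ p i)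
    (ξ : ℕ → Ω → ℕ) (hmeas : ∀ m, Measurable (ξ m))
    (hindep : iIndepFun ξ ℙ)
    (hlaw : ∀ m i, i < k → ℙ {ω | ξ m ω = i} = ENNReal.ofReal (p i))
    (n : ℕ) (g : ℕ → ℕ → ℤ)
    (hg0 : ∀ i, i < k → g i 0 = 0)
    (hgstep : ∀ m, 1 ≤ m → m ≤ n →
      ∃ j, j < k ∧ g j m = g j (m-1) + 1 ∧ ∀ i, i < k → i ≠ j → g i m = g i (m-1))
    (hgW : ∀ m ≤ n, ∀ i, i + 1 < k → g i m ≤ g (i+1) m) :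
    ℙ {ω | ∀ m ≤ n, ∀ i, i < k →
            G k (fun i' n' => Xcnt ξ i' n' ω) i m = g i m}
      = ENNReal.ofReal (schur k (revPartZ k (fun i => g i n)) p) := by
  have hnn : ∀ m, m ≤ n → ∀ i, i < k → 0 ≤ g i m := by
    intro m
    induction m with
    | zero => intro _ i hi; rw [hg0 i hi]
    | succ m ih =>
      intro hm i hi
      obtain ⟨j, hj, h1, h2⟩ := hgstep (m+1) (by omega) hm
      have h3 := ih (by omega) i hi
      simp only [Nat.add_sub_cancel] at h1 h2
      by_cases hij : i = j
      · subst hij; omega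
      · rw [h2 i hi hij]; exact h3
  rw [← prob_path k p hp0 ξ hmeas hindep hlaw (fun m => revPartZ k (fun i => g i m))]
  · congr 1
    ext ω
    simp only [Set.mem_ofPred_eq]
    refine forall_congr' fun m => forall_congr' fun hm => ?_
    obtain ⟨k, rfl⟩ : ∃ k', k = k' + 1 := ⟨k - 1, by omega⟩
    have hG := G_eq (fun j => ξ j ω) k
    have hX : (fun i' n' => Xcnt ξ i' n' ω) = cnt (fun j => ξ j ω) := rfl
    rw [hX]
    constructor
    · intro h r
      unfold revPartZ
      by_cases hr : r < k + 1
      · rw [if_pos hr]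
        simp only
        rw [← h _ (show k + 1 - 1 - r < k + 1 by omega), hG _ (by omega)]
        simp only [Int.toNat_natCast]
        congr 1; omega
      · rw [if_neg hr]
        exact (Zof_pat _ (k+1) m).zero _ le_rfl _ (by omega)
    · intro h i hi
      rw [hG i hi]
      simp only
      rw [h (k-i)]
      unfold revPartZ
      rw [if_pos (by omega), show k + 1 - 1 - (k - i) = i by omega]
      exact Int.toNat_of_nonneg (hnn m hm i hi)
  · intro r
    simp only [revPartZ]
    split_ifs
    · rw [hg0 _ (by omega)]; rfl
    · rfl
  · intro m hm
    obtain ⟨j, hj, h1, h2⟩ := hgstep (m+1) (by omega) hm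
    simp only [Nat.add_sub_cancel] at h1 h2
    refine ⟨k - 1 - j, fun r => ?_⟩
    simp only [revPartZ]
    by_cases hr : r < k
    · rw [if_pos hr, if_pos hr]
      have h4 := hnn m (by omega) (k-1-r) (by omega)
      by_cases hrj : r = k - 1 - j
      · rw [if_pos hrj]
        have : k - 1 - r = j := by omega
        rw [this] at h4 ⊢
        omega
      · rw [if_neg hrj, h2 (k-1-r) (by omega) (by omega)]; rfl
    · rw [if_neg hr, if_neg hr, if_neg (by omega)]
  · intro m hm r
    simp only [revPartZ]
    by_cases hr : r + 1 < k
    · rw [if_pos hr, if_pos (by omega)]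
      have := hgW m hm (k-1-(r+1)) (by omega)
      rw [show k - 1 - (r+1) + 1 = k - 1 - r by omega] at this
      exact Int.toNat_le_toNat this
    · rw [if_neg hr]; exact Nat.zero_le _
  · intro r hr
    simp only [revPartZ]
    rw [if_neg (by omega)]

/-- the transformed walk `Ĝ = G^{(k)}(X)` is a Markov chain on
`W ∩ ℤ_+^k` with transition probabilities `P̂(x,y) = s_{y^*}(p)/s_{x^*}(p)` for
`y - x ∈ {e_1,…,e_k}` (stated multiplied through by the Schur functions). -/
theorem stmt12 {Ω : Type*} [MeasureSpace Ω] [IsProbabilityMeasure (ℙ : Measure Ω)]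
    (k : ℕ) (hk : 2 ≤ k) (p : ℕ → ℝ)
    (hp0 : ∀ i, i < k → 0 ≤ p i)
    (hsum : ∑ i ∈ Finset.range k, p i = 1)
    (ξ : ℕ → Ω → ℕ) (hmeas : ∀ m, Measurable (ξ m))
    (hindep : iIndepFun ξ ℙ)
    (hlaw : ∀ m i, i < k → ℙ {ω | ξ m ω = i} = ENNReal.ofReal (p i))
    (n : ℕ) (g : ℕ → ℕ → ℤ)
    (hg0 : ∀ i, i < k → g i 0 = 0)
    (hgstep : ∀ m, 1 ≤ m → m ≤ n →
      ∃ j, j < k ∧ g j m = g j (m-1) + 1 ∧ ∀ i, i < k → i ≠ j → g i m = g i (m-1))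
    (hgW : ∀ m ≤ n, ∀ i, i + 1 < k → g i m ≤ g (i+1) m)
    (y : ℕ → ℤ)
    (hy0 : ∀ i, i < k → 0 ≤ y i)
    (hyW : ∀ i, i + 1 < k → y i ≤ y (i+1))
    (hystep : ∃ j, j < k ∧ y j = g j n + 1 ∧ ∀ i, i < k → i ≠ j → y i = g i n) :
    ENNReal.ofReal (schur k (revPartZ k (fun i => g i n)) p)
      * ℙ {ω | (∀ m ≤ n, ∀ i, i < k →
            G k (fun i' n' => Xcnt ξ i' n' ω) i m = g i m) ∧
          (∀ i, i < k → G k (fun i' n' => Xcnt ξ i' n' ω) i (n+1) = y i)}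
    = ENNReal.ofReal (schur k (revPartZ k y) p)
      * ℙ {ω | ∀ m ≤ n, ∀ i, i < k →
            G k (fun i' n' => Xcnt ξ i' n' ω) i m = g i m} := by
  have e1 := prob_G k hk p hp0 ξ hmeas hindep hlaw n g hg0 hgstep hgW
  have e2 := prob_G k hk p hp0 ξ hmeas hindep hlaw (n+1)
    (fun i m => if m ≤ n then g i m else y i)
    (by intro i hi; simp [hg0 i hi])
    (by
      intro m h1 h2
      by_cases hm : m ≤ n
      · obtain ⟨j, hj, h3, h4⟩ := hgstep m h1 hm
        refine ⟨j, hj, ?_, ?_⟩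
        · simp only [if_pos hm, if_pos (show m - 1 ≤ n by omega)]; exact h3
        · intro i hi hij
          simp only [if_pos hm, if_pos (show m - 1 ≤ n by omega)]; exact h4 i hi hij
      · obtain rfl : m = n + 1 := by omega
        obtain ⟨j, hj, h3, h4⟩ := hystep
        refine ⟨j, hj, ?_, ?_⟩
        · simp; exact h3
        · intro i hi hij
          simp; exact h4 i hi hij)
    (by
      intro m h1 i hi
      by_cases hm : m ≤ n
      · simp only [if_pos hm]; exact hgW m hm i hi
      · simp only [if_neg hm]; exact hyW i hi)
  have e3 : {ω | (∀ m ≤ n, ∀ i, i < k →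
            G k (fun i' n' => Xcnt ξ i' n' ω) i m = g i m) ∧
          (∀ i, i < k → G k (fun i' n' => Xcnt ξ i' n' ω) i (n+1) = y i)}
      = {ω | ∀ m ≤ n + 1, ∀ i, i < k →
            G k (fun i' n' => Xcnt ξ i' n' ω) i m = if m ≤ n then g i m else y i} := by
    ext ω
    simp only [Set.mem_ofPred_eq]
    constructor
    · rintro ⟨h1, h2⟩ m hm i hi
      by_cases hmn : m ≤ n
      · rw [if_pos hmn]; exact h1 m hmn i hi
      · obtain rfl : m = n + 1 := by omega
        rw [if_neg hmn]; exact h2 i hi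
    · intro h
      refine ⟨fun m hm i hi => ?_, fun i hi => ?_⟩
      · have := h m (by omega) i hi
        rwa [if_pos hm] at this
      · have := h (n+1) le_rfl i hi
        rwa [if_neg (by omega)] at this
  rw [e3, e2, e1, mul_comm]
  simp
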